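/- Let G be a finite simple graph and let a, s, b, w be vertices of G such that a and s lie in the same connected component, s and w lie in the same connected component, and b and w lie in the same connected component. Then the least t ∈ ℕ for which there exist trajectories p and q of G satisfying p 0 = a, p τ = s for some τ ≤ t, p t = w, q 0 = b, and q t = w equals max{d(a,s) + d(s,w), d(b,w)}. (This is the earliest possible meeting time at w for a task with start vertex s, an initiator agent starting at a, and an executor agent starting at b.) -/

import Mathlib

/-- A trajectory of a graph: at each time step the agent either waits or
moves along an edge. -/
def IsTrajectory {V : Type*} (G : SimpleGraph V) (p : ℕ → V) : Prop :=
  ∀ t : ℕ, p (t + 1) = p t ∨ G.Adj (p t) (p (t + 1))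

theorem SimpleGraph.Walk.isTrajectory_getVert {V : Type*} {G : SimpleGraph V} {u v : V}
    (c : G.Walk u v) : IsTrajectory G c.getVert := by
  intro t
  rcases lt_or_ge t c.length with h | h
  · exact Or.inr (c.adj_getVert_succ h)
  · left
    rw [c.getVert_of_length_le h, c.getVert_of_length_le (by omega)]

theorem IsTrajectory.exists_walk_length_le {V : Type*} {G : SimpleGraph V} {p : ℕ → V}
    (hp : IsTrajectory G p) (i n : ℕ) :
    ∃ c : G.Walk (p i) (p (i + n)), c.length ≤ n := by
  induction n with
  | zero => exact ⟨.nil, le_rfl⟩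
  | succ n ih =>
    obtain ⟨c, hc⟩ := ih
    rcases hp (i + n) with h | h
    · exact ⟨c.copy rfl h.symm, by simpa using hc.trans n.le_succ⟩
    · exact ⟨c.concat h, by simpa using hc⟩

theorem IsTrajectory.dist_le {V : Type*} {G : SimpleGraph V} {p : ℕ → V}
    (hp : IsTrajectory G p) {i j : ℕ} (hij : i ≤ j) :
    G.dist (p i) (p j) ≤ j - i := by
  obtain ⟨n, rfl⟩ := Nat.exists_eq_add_of_le hij
  obtain ⟨c, hc⟩ := hp.exists_walk_length_le i n
  have := SimpleGraph.dist_le c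
  omega

/-- The earliest possible meeting time at `w` for a task with start vertex `s`,
an initiator agent starting at `a` and an executor agent starting at `b`,
equals `max (d(a,s) + d(s,w)) (d(b,w))`. -/
theorem earliest_meeting_time {V : Type*} [Fintype V] (G : SimpleGraph V)
    (a s b w : V)
    (has : G.Reachable a s) (hsw : G.Reachable s w) (hbw : G.Reachable b w) :
    IsLeast {t : ℕ | ∃ p q : ℕ → V, IsTrajectory G p ∧ IsTrajectory G q ∧
        p 0 = a ∧ (∃ τ ≤ t, p τ = s) ∧ p t = w ∧ q 0 = b ∧ q t = w}
      (max (G.dist a s + G.dist s w) (G.dist b w)) := by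
  constructor
  · obtain ⟨c, hc⟩ := has.exists_walk_length_eq_dist
    obtain ⟨d, hd⟩ := hsw.exists_walk_length_eq_dist
    obtain ⟨e, he⟩ := hbw.exists_walk_length_eq_dist
    refine ⟨(c.append d).getVert, e.getVert, (c.append d).isTrajectory_getVert,
      e.isTrajectory_getVert, by simp, ⟨c.length, by omega, ?_⟩, ?_, by simp, ?_⟩
    · simp [SimpleGraph.Walk.getVert_append]
    · apply SimpleGraph.Walk.getVert_of_length_le
      rw [SimpleGraph.Walk.length_append]
      omega
    · exact e.getVert_of_length_le (by omega)
  · rintro t ⟨p, q, hp, hq, rfl, ⟨τ, hτ, rfl⟩, rfl, rfl, hqt⟩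
    have h₁ := hp.dist_le τ.zero_le
    have h₂ := hp.dist_le hτ
    have h₃ := hq.dist_le t.zero_le
    rw [hqt] at h₃
    omega
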